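/- The flipped generalized polynomial ring S = R[X;σ,δ]^fl is a flipped non-associative Ore extension of R with x = X; concretely: (a) S is a free left R-module with basis {1, X, X², ...}; (b) X·r = σ(r)X + δ(r) for all r ∈ R; and (c) for all m, n ∈ ℕ and r, s ∈ R, (rX^{m+1})(sX^n) = ((rX^m)(σ(s)X^n))·X + (rX^m)(δ(s)X^n) and r·(sX^n) = τ_n(r,s)X^n. -/

import Mathlib

/-- The π-functions `piFun σ δ m i = π_i^m`. -/
def piFun {R : Type*} [NonAssocRing R] (σ δ : R → R) : ℕ → ℕ → R → R
  | 0, 0, r => r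
  | 0, _+1, _ => 0
  | m+1, 0, r => δ (piFun σ δ m 0 r)
  | m+1, i+1, r => σ (piFun σ δ m i r) + δ (piFun σ δ m (i+1) r)

/-- `tau n r s = rs` if `n` is even and `sr` if `n` is odd. -/
def tau {R : Type*} [NonAssocRing R] (n : ℕ) (r s : R) : R :=
  if Even n then r * s else s * r

/-- The multiplication of the flipped generalized polynomial ring `R[X;σ,δ]^fl`:
the biadditive extension of `(rX^m)(sX^n) = Σ_i τ_n(r, π_i^m(s)) X^{i+n}`. Polynomials
are represented as finitely supported functions `ℕ →₀ R`. -/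
noncomputable def flipMul {R : Type*} [NonAssocRing R] (σ δ : R → R) (p q : ℕ →₀ R) : ℕ →₀ R :=
  p.sum fun m r => q.sum fun n s =>
    ∑ i ∈ Finset.range (m+1), Finsupp.single (i+n) (tau n r (piFun σ δ m i s))

theorem piFun_map_zero {R : Type*} [NonAssocRing R] (σ δ : R →+ R) (m i : ℕ) :
    piFun σ δ m i 0 = 0 := by
  induction m generalizing i with
  | zero => cases i <;> rfl
  | succ m ih => cases i <;> simp [piFun, ih]

theorem piFun_of_lt {R : Type*} [NonAssocRing R] (σ δ : R →+ R) {m i : ℕ} (h : m < i) (s : R) :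
    piFun σ δ m i s = 0 := by
  induction m generalizing i with
  | zero =>
    obtain _ | i := i
    · omega
    · rfl
  | succ m ih =>
    obtain _ | i := i
    · omega
    · simp [piFun, ih (show m < i by omega), ih (show m < i + 1 by omega)]

theorem piFun_succ_zero_apply {R : Type*} [NonAssocRing R] (σ δ : R →+ R) (m : ℕ) (s : R) :
    piFun σ δ (m + 1) 0 s = piFun σ δ m 0 (δ s) := by
  induction m with
  | zero => rfl
  | succ m ih => rw [piFun, ih, piFun]

theorem piFun_succ_succ_apply {R : Type*} [NonAssocRing R] (σ δ : R →+ R) (m i : ℕ) (s : R) :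
    piFun σ δ (m + 1) (i + 1) s = piFun σ δ m i (σ s) + piFun σ δ m (i + 1) (δ s) := by
  induction m generalizing i with
  | zero => cases i <;> simp [piFun]
  | succ m ih =>
    rw [piFun, ih, map_add]
    cases i with
    | zero => rw [piFun_succ_zero_apply σ δ m s]; simp only [piFun]; abel
    | succ i => rw [ih, map_add]; simp only [piFun]; abel

theorem piFun_one {R : Type*} [NonAssocRing R] (σ δ : R →+ R) (hσ : σ 1 = 1) (hδ : δ 1 = 0)
    (m i : ℕ) : piFun σ δ m i 1 = if i = m then 1 else 0 := by
  induction m generalizing i with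
  | zero => cases i <;> simp [piFun]
  | succ m ih =>
    obtain _ | i := i
    · rw [piFun_succ_zero_apply, hδ, piFun_map_zero]; simp
    · rw [piFun_succ_succ_apply, hδ, hσ, piFun_map_zero, ih]; simp

theorem tau_zero_left {R : Type*} [NonAssocRing R] (n : ℕ) (s : R) : tau n 0 s = 0 := by
  simp [tau]

theorem tau_zero_right {R : Type*} [NonAssocRing R] (n : ℕ) (r : R) : tau n r 0 = 0 := by
  simp [tau]

theorem tau_one_right {R : Type*} [NonAssocRing R] (n : ℕ) (r : R) : tau n r 1 = r := by
  simp [tau]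

theorem tau_add_right {R : Type*} [NonAssocRing R] (n : ℕ) (r s t : R) :
    tau n r (s + t) = tau n r s + tau n r t := by
  unfold tau; split_ifs
  · exact mul_add r s t
  · exact add_mul s t r

theorem flipMul_single_single {R : Type*} [NonAssocRing R] (σ δ : R →+ R) (m n : ℕ) (r s : R) :
    flipMul σ δ (Finsupp.single m r) (Finsupp.single n s) =
      ∑ i ∈ Finset.range (m + 1), Finsupp.single (i + n) (tau n r (piFun σ δ m i s)) := by
  unfold flipMul
  rw [Finsupp.sum_single_index, Finsupp.sum_single_index]
  · simp [piFun_map_zero, tau_zero_right]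
  · simp [tau_zero_left]

theorem flipMul_single_zero_single {R : Type*} [NonAssocRing R] (σ δ : R →+ R) (n : ℕ) (r s : R) :
    flipMul σ δ (Finsupp.single 0 r) (Finsupp.single n s) = Finsupp.single n (tau n r s) := by
  simp [flipMul_single_single, piFun]

theorem flipMul_X {R : Type*} [NonAssocRing R] (σ δ : R →+ R) (hσ : σ 1 = 1) (hδ : δ 1 = 0)
    (p : ℕ →₀ R) : flipMul σ δ p (Finsupp.single 1 1) = p.mapDomain (· + 1) := by
  unfold flipMul Finsupp.mapDomain
  refine Finsupp.sum_congr fun k _ => ?_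
  rw [Finsupp.sum_single_index (by simp [piFun_map_zero, tau_zero_right]),
    Finset.sum_eq_single_of_mem k (by simp)]
  · simp [piFun_one σ δ hσ hδ, tau_one_right]
  · intro i _ hi
    simp [piFun_one σ δ hσ hδ, hi, tau_zero_right]

/-- `S = R[X;σ,δ]^fl` is a flipped non-associative Ore extension of `R` with
`x = X`: (a) `S` is a free left `R`-module (via ring multiplication on the left) with basis
`{1, X, X², …}`; (b) `X·r = σ(r)X + δ(r)`; (c) the identities (F3) hold. -/
theorem flipped_generalized_polynomial_ring_is_flipped_ore_extension
    {R : Type*} [NonAssocRing R] (σ δ : R →+ R) (hσ : σ 1 = 1) (hδ : δ 1 = 0) :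
    -- (a) freeness: every element is uniquely a finite sum `Σ_i r_i · X^i`
    (∀ p : ℕ →₀ R, ∃! c : ℕ →₀ R,
      p = c.sum fun i r =>
        flipMul (σ : R → R) (δ : R → R) (Finsupp.single 0 r) (Finsupp.single i 1)) ∧
    -- (b) `X·r = σ(r)X + δ(r)`
    (∀ r : R,
      flipMul (σ : R → R) (δ : R → R) (Finsupp.single 1 1) (Finsupp.single 0 r)
        = Finsupp.single 1 (σ r) + Finsupp.single 0 (δ r)) ∧
    -- (c) `(rX^{m+1})(sX^n) = ((rX^m)(σ(s)X^n))·X + (rX^m)(δ(s)X^n)`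
    (∀ (m n : ℕ) (r s : R),
      flipMul (σ : R → R) (δ : R → R) (Finsupp.single (m+1) r) (Finsupp.single n s)
        = flipMul (σ : R → R) (δ : R → R)
            (flipMul (σ : R → R) (δ : R → R) (Finsupp.single m r) (Finsupp.single n (σ s)))
            (Finsupp.single 1 1)
          + flipMul (σ : R → R) (δ : R → R) (Finsupp.single m r) (Finsupp.single n (δ s))) ∧
    -- (c') `r·(sX^n) = τ_n(r,s)X^n`
    (∀ (n : ℕ) (r s : R),
      flipMul (σ : R → R) (δ : R → R) (Finsupp.single 0 r) (Finsupp.single n s)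
        = Finsupp.single n (tau n r s)) := by
  refine ⟨fun p => ?_, fun r => ?_, fun m n r s => ?_, flipMul_single_zero_single σ δ⟩
  · simp only [flipMul_single_zero_single, tau_one_right]
    exact ⟨p, p.sum_single.symm, fun c hc => (hc.trans c.sum_single).symm⟩
  · simp [flipMul_single_single, Finset.sum_range_succ, piFun, tau, add_comm]
  · rw [flipMul_X σ δ hσ hδ]
    simp only [flipMul_single_single, Finsupp.mapDomain_finsetSum, Finsupp.mapDomain_single]
    rw [Finset.sum_range_succ' _ (m + 1), Finset.sum_range_succ'
      (fun i => Finsupp.single (i + n) (tau n r (piFun σ δ m i (δ s)))) m]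
    simp only [piFun_succ_zero_apply, piFun_succ_succ_apply, tau_add_right, Finsupp.single_add,
      Finset.sum_add_distrib]
    rw [Finset.sum_range_succ (fun i => Finsupp.single (i + 1 + n)
      (tau n r (piFun σ δ m (i + 1) (δ s)))), piFun_of_lt σ δ m.lt_succ_self,
      tau_zero_right, Finsupp.single_zero, add_zero]
    simp only [add_right_comm _ 1 n, add_assoc]
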